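/- Let D be a coherent acyclic orientation of a cut subgraph of G. Then the linear spans satisfy ℝσ_D = F_ℝ ∩ ℝσ_{𝔼(D)}: the linear span of the cone σ_D equals the intersection of the cut space F_ℝ with the linear span of the cone σ_{𝔼(D)}. -/

import Mathlib

open scoped Classical

/-- A finite loopless multigraph presented by its set of *oriented* edges:
each edge gives rise to two oriented edges, swapped by the fixed-point-free
involution `rev`. -/
structure OrGraph where
  V : Type
  EO : Type
  fintV : Fintype V
  fintEO : Fintype EO
  decV : DecidableEq V
  decEO : DecidableEq EO
  rev : EO → EO
  tail : EO → V
  head : EO → V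
  rev_rev : ∀ e, rev (rev e) = e
  rev_ne : ∀ e, rev e ≠ e
  head_rev : ∀ e, head (rev e) = tail e
  tail_rev : ∀ e, tail (rev e) = head e

attribute [instance] OrGraph.fintV OrGraph.fintEO OrGraph.decV OrGraph.decEO

namespace OrGraph

variable (G : OrGraph)

/-- Adjacency: there is an oriented edge from `u` to `v`. -/
def Adj (u v : G.V) : Prop := ∃ e, G.tail e = u ∧ G.head e = v

/-- The graph is connected. -/
def Connected : Prop := ∀ u v : G.V, Relation.ReflTransGen G.Adj u v

/-- `g : 𝔼 → A` is a 1-cochain, i.e. `g(ē) = -g(e)`. -/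
def IsC1 {A : Type} [Neg A] (g : G.EO → A) : Prop := ∀ e, g (G.rev e) = - g e

/-- The differential `d : C^0(G,A) → C^1(G,A)`, `d(f)(uv) = f(v) - f(u)`. -/
def d {A : Type} [Sub A] (f : G.V → A) : G.EO → A :=
  fun e => f (G.head e) - f (G.tail e)

/-- The adjoint `d* : C^1(G,A) → C^0(G,A)`, `d*(g)(v) = ∑_{head e = v} g(e)`. -/
def dstar {A : Type} [AddCommMonoid A] (g : G.EO → A) : G.V → A :=
  fun v => ∑ e ∈ Finset.univ.filter (fun e => G.head e = v), g e

/-- The 1-cochain `χ_e - χ_ē`: value `1` at `e`, `-1` at `ē`, `0` elsewhere. -/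
def chi (A : Type) [Zero A] [One A] [Neg A] (e : G.EO) : G.EO → A :=
  fun f => if f = e then 1 else if f = G.rev e then -1 else 0

/-- The set `S ⊆ V` induces a connected subgraph. -/
def ConnectedOn (S : Set G.V) : Prop :=
  ∀ u ∈ S, ∀ v ∈ S,
    Relation.ReflTransGen (fun a b => a ∈ S ∧ b ∈ S ∧ G.Adj a b) u v

/-- `β` is a bond element: `β = d(χ_X)` with `X` nonempty, proper, and both
`G[X]` and `G[V-X]` connected. -/
def IsBond (β : G.EO → ℝ) : Prop :=
  ∃ X : Finset G.V, X.Nonempty ∧ Xᶜ.Nonempty ∧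
    G.ConnectedOn ↑X ∧ G.ConnectedOn ↑(Xᶜ) ∧
    β = G.d (fun v => if v ∈ X then (1 : ℝ) else 0)

/-- The positive support of a real 1-cochain. -/
def suppPlus (x : G.EO → ℝ) : Set G.EO := {e | 0 < x e}

/-- The cone generated by a set of vectors: all finite nonnegative combinations. -/
def coneGen (S : Set (G.EO → ℝ)) : Set (G.EO → ℝ) :=
  { x | ∃ (t : Finset (G.EO → ℝ)) (c : (G.EO → ℝ) → ℝ),
      (∀ y ∈ t, y ∈ S) ∧ (∀ y ∈ t, 0 ≤ c y) ∧ x = ∑ y ∈ t, c y • y }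

/-- `D ⊆ 𝔼` is a coherent acyclic orientation of a cut subgraph of `G`:
for some ordered partition of `V` (encoded by `r : V → ℕ`), `D` consists of
the oriented edges going from a smaller part to a bigger part. -/
def IsCAC (D : Set G.EO) : Prop :=
  ∃ r : G.V → ℕ, D = {e | r (G.tail e) < r (G.head e)}

/-- The cone `σ_D` generated by the bond elements with positive support in `D`. -/
def bondCone (D : Set G.EO) : Set (G.EO → ℝ) :=
  G.coneGen {β | G.IsBond β ∧ G.suppPlus β ⊆ D}

/-- The cone `σ_{𝔼(D)}` generated by the `χ_e - χ_ē` for `e ∈ D`. -/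
def edgeCone (D : Set G.EO) : Set (G.EO → ℝ) :=
  G.coneGen {x | ∃ e ∈ D, x = G.chi ℝ e}

/-- The cut space `F_ℝ`, the image of `d : C^0(G,ℝ) → C^1(G,ℝ)`. -/
def cutSpace : Set (G.EO → ℝ) := {x | ∃ f : G.V → ℝ, x = G.d f}

/-- `γ` is an oriented cycle: a nonempty cyclic sequence of oriented edges with
pairwise distinct underlying edges, the head of each being the tail of the next. -/
def IsCycle (γ : List G.EO) : Prop :=
  γ ≠ [] ∧
  (∀ i : Fin γ.length,
    G.head (γ.get i) = G.tail (γ.get ⟨((i : ℕ) + 1) % γ.length, Nat.mod_lt _ i.pos⟩)) ∧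
  (∀ i j : Fin γ.length, i ≠ j → γ.get i ≠ γ.get j ∧ γ.get i ≠ G.rev (γ.get j))

/-- `δ^{𝔪,n}_e(f) = ⌊(f(head e) - f(tail e) + n 𝔪_e)/(n ℓ_e)⌋`. -/
def ddelta (ℓ : G.EO → ℕ) (m : G.EO → ℤ) (n : ℕ) (f : G.V → ℤ) (e : G.EO) : ℤ :=
  ⌊((f (G.head e) : ℚ) - (f (G.tail e) : ℚ) + (n : ℚ) * (m e : ℚ)) /
    ((n : ℚ) * (ℓ e : ℚ))⌋

/-- `𝔡^{𝔪,n}_f(e) = (δ^{𝔪,n}_e(f) - δ^{𝔪,n}_{ē}(f))/2`. -/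
def dd (ℓ : G.EO → ℕ) (m : G.EO → ℤ) (n : ℕ) (f : G.V → ℤ) (e : G.EO) : ℚ :=
  ((G.ddelta ℓ m n f e : ℚ) - (G.ddelta ℓ m n f (G.rev e) : ℚ)) / 2

end OrGraph

namespace OrGraph

variable (G : OrGraph)

lemma span_coneGen (S : Set (G.EO → ℝ)) :
    Submodule.span ℝ (G.coneGen S) = Submodule.span ℝ S := by
  apply le_antisymm
  · rw [Submodule.span_le]
    rintro x ⟨t, c, ht, -, rfl⟩
    exact Submodule.sum_mem _ fun y hy =>
      Submodule.smul_mem _ _ (Submodule.subset_span (ht y hy))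
  · apply Submodule.span_mono
    intro x hx
    exact ⟨{x}, fun _ => 1, by simpa using hx, by simp, by simp⟩

/-- The differential as a linear map. -/
def dLinear : (G.V → ℝ) →ₗ[ℝ] (G.EO → ℝ) where
  toFun := G.d
  map_add' f g := by ext e; simp only [d, Pi.add_apply]; ring
  map_smul' c f := by
    ext e; simp only [d, Pi.smul_apply, smul_eq_mul, RingHom.id_apply]; ring

lemma dLinear_apply (f : G.V → ℝ) : G.dLinear f = G.d f := rfl

/-- The real-valued characteristic function of a vertex set. -/
def ind (X : Finset G.V) : G.V → ℝ := fun v => if v ∈ X then 1 else 0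

/-- The oriented edges with exactly one endpoint in `X`. -/
def cutEdges (X : Finset G.V) : Finset G.EO :=
  Finset.univ.filter fun e => ¬ (G.head e ∈ X ↔ G.tail e ∈ X)

lemma ind_lt_ind_iff (X : Finset G.V) (u v : G.V) :
    G.ind X u < G.ind X v ↔ u ∉ X ∧ v ∈ X := by
  unfold ind
  split_ifs <;> simp_all

lemma cutEdges_compl (X : Finset G.V) : G.cutEdges Xᶜ = G.cutEdges X := by
  ext e
  simp [cutEdges, not_iff_not]

lemma d_ind_compl (X : Finset G.V) : G.d (G.ind Xᶜ) = - G.d (G.ind X) := by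
  ext e
  simp only [d, ind, Finset.mem_compl, Pi.neg_apply]
  split_ifs <;> simp_all

lemma d_ind_union {A B : Finset G.V} (h : Disjoint A B) :
    G.d (G.ind (A ∪ B)) = G.d (G.ind A) + G.d (G.ind B) := by
  have hi : G.ind (A ∪ B) = G.ind A + G.ind B := by
    ext v
    have : v ∈ A → v ∉ B := fun hv => Finset.disjoint_left.mp h hv
    simp only [ind, Finset.mem_union, Pi.add_apply]
    split_ifs <;> simp_all
  rw [hi, ← dLinear_apply, map_add]
  rfl

variable {G}

lemma Adj.symm {u v : G.V} (h : G.Adj u v) : G.Adj v u := by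
  obtain ⟨e, rfl, rfl⟩ := h
  exact ⟨G.rev e, G.tail_rev e, G.head_rev e⟩

lemma Connected.exists_cutEdge (hconn : G.Connected) {X : Finset G.V}
    (hX : X.Nonempty) (hX' : Xᶜ.Nonempty) : (G.cutEdges X).Nonempty := by
  obtain ⟨u, hu⟩ := hX
  obtain ⟨v, hv⟩ := hX'
  by_contra hne
  rw [Finset.not_nonempty_iff_eq_empty] at hne
  have key : ∀ w, Relation.ReflTransGen G.Adj u w → w ∈ X := by
    intro w hw
    induction hw with
    | refl => exact hu
    | tail _ hbc ih =>
      obtain ⟨e, rfl, rfl⟩ := hbc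
      by_contra hc
      have : e ∈ G.cutEdges X := by simp [cutEdges, hc, ih]
      simp [hne] at this
  exact Finset.mem_compl.mp hv (key v (hconn u v))

lemma exists_split_of_not_connectedOn {X : Finset G.V} (h : ¬ G.ConnectedOn ↑X) :
    ∃ A B : Finset G.V, A.Nonempty ∧ B.Nonempty ∧ Disjoint A B ∧ A ∪ B = X ∧
      ∀ a ∈ A, ∀ b ∈ B, ¬ G.Adj a b := by
  unfold ConnectedOn at h
  push Not at h
  obtain ⟨u, hu, v, hv, huv⟩ := h
  let R : G.V → Prop := fun w =>
    Relation.ReflTransGen (fun a b => a ∈ (X : Set G.V) ∧ b ∈ (X : Set G.V) ∧ G.Adj a b) u w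
  refine ⟨X.filter R, X.filter fun w => ¬ R w,
    ⟨u, Finset.mem_filter.mpr ⟨hu, Relation.ReflTransGen.refl⟩⟩,
    ⟨v, Finset.mem_filter.mpr ⟨hv, huv⟩⟩,
    Finset.disjoint_filter_filter_not _ _ _, Finset.filter_union_filter_not_eq _ _, ?_⟩
  intro a ha b hb hab
  rw [Finset.mem_filter] at ha hb
  exact hb.2 (ha.2.tail ⟨ha.1, hb.1, hab⟩)

lemma Connected.cutEdges_ssubset (hconn : G.Connected) {A B : Finset G.V}
    (hA : A.Nonempty) (hB : B.Nonempty) (hd : Disjoint A B)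
    (hadj : ∀ a ∈ A, ∀ b ∈ B, ¬ G.Adj a b) :
    G.cutEdges A ⊂ G.cutEdges (A ∪ B) := by
  have hAB : ∀ v, v ∈ A → v ∉ B := fun v hv => Finset.disjoint_left.mp hd hv
  have h1 : ∀ e, G.tail e ∈ A → G.head e ∉ B := fun e ha hb => hadj _ ha _ hb ⟨e, rfl, rfl⟩
  have h2 : ∀ e, G.head e ∈ A → G.tail e ∉ B := fun e ha hb =>
    hadj _ ha _ hb (Adj.symm ⟨e, rfl, rfl⟩)
  obtain ⟨a, ha⟩ := hA
  obtain ⟨e, he⟩ := hconn.exists_cutEdge hB ⟨a, Finset.mem_compl.mpr (hAB a ha)⟩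
  rw [Finset.ssubset_iff_of_subset]
  · refine ⟨e, ?_, ?_⟩ <;>
    · have := h1 e
      have := h2 e
      have := hAB (G.head e)
      have := hAB (G.tail e)
      simp only [cutEdges, Finset.mem_filter, Finset.mem_univ, true_and, Finset.mem_union] at he ⊢
      tauto
  · intro e he
    have := h1 e
    have := h2 e
    have := hAB (G.head e)
    have := hAB (G.tail e)
    simp only [cutEdges, Finset.mem_filter, Finset.mem_univ, true_and, Finset.mem_union] at he ⊢
    tauto

/-- A cut whose positive support lies in `D` is a combination of bonds with positive support
in `D`. -/
lemma Connected.d_ind_mem_span (hconn : G.Connected) (D : Set G.EO) (X : Finset G.V)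
    (hX : ∀ e, G.tail e ∉ X → G.head e ∈ X → e ∈ D) :
    G.d (G.ind X) ∈ Submodule.span ℝ {β | G.IsBond β ∧ G.suppPlus β ⊆ D} := by
  induction hn : (G.cutEdges X).card using Nat.strong_induction_on generalizing X with
  | _ n ih =>
  subst hn
  rcases X.eq_empty_or_nonempty with rfl | hne
  · have : G.d (G.ind ∅) = 0 := by ext e; simp [d, ind]
    rw [this]; exact Submodule.zero_mem _
  rcases Xᶜ.eq_empty_or_nonempty with hc | hne'
  · have : G.d (G.ind X) = 0 := by
      rw [Finset.compl_eq_empty_iff] at hc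
      ext e; simp [d, ind, hc]
    rw [this]; exact Submodule.zero_mem _
  by_cases h1 : G.ConnectedOn ↑X
  · by_cases h2 : G.ConnectedOn ↑(Xᶜ)
    · refine Submodule.subset_span ⟨⟨X, hne, hne', h1, h2, rfl⟩, fun e he => ?_⟩
      have := (G.ind_lt_ind_iff X _ _).mp (sub_pos.mp he)
      exact hX e this.1 this.2
    · obtain ⟨A, B, hA, hB, hd, hU, hadj⟩ := exists_split_of_not_connectedOn h2
      have hs := hconn.cutEdges_ssubset hA hB hd hadj
      have hs' := hconn.cutEdges_ssubset hB hA hd.symm fun b hb a ha h => hadj a ha b hb h.symm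
      rw [Finset.union_comm] at hs'
      have hmem : ∀ v, v ∉ X ↔ v ∈ A ∨ v ∈ B := fun v => by
        rw [← Finset.mem_compl, ← hU, Finset.mem_union]
      have hsum : G.d (G.ind X) = G.d (G.ind Aᶜ) + G.d (G.ind Bᶜ) := by
        rw [← compl_compl X, ← hU, d_ind_compl, d_ind_union G hd, d_ind_compl, d_ind_compl,
          neg_add]
      rw [hU, cutEdges_compl] at hs hs'
      rw [hsum]
      refine Submodule.add_mem _
        (ih _ (Finset.card_lt_card (by rwa [← G.cutEdges_compl A] at hs)) _ ?_ rfl)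
        (ih _ (Finset.card_lt_card (by rwa [← G.cutEdges_compl B] at hs')) _ ?_ rfl)
      · intro e ht hh
        simp only [Finset.mem_compl, not_not] at ht hh
        refine hX e ((hmem _).2 (.inl ht)) (by_contra fun hc => ?_)
        exact hadj _ ht _ (((hmem _).1 hc).resolve_left hh) ⟨e, rfl, rfl⟩
      · intro e ht hh
        simp only [Finset.mem_compl, not_not] at ht hh
        refine hX e ((hmem _).2 (.inr ht)) (by_contra fun hc => ?_)
        exact hadj _ (((hmem _).1 hc).resolve_right hh) _ ht (Adj.symm ⟨e, rfl, rfl⟩)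
  · obtain ⟨A, B, hA, hB, hd, rfl, hadj⟩ := exists_split_of_not_connectedOn h1
    have hs := hconn.cutEdges_ssubset hA hB hd hadj
    have hs' := hconn.cutEdges_ssubset hB hA hd.symm fun b hb a ha h => hadj a ha b hb h.symm
    rw [Finset.union_comm] at hs'
    rw [d_ind_union G hd]
    refine Submodule.add_mem _ (ih _ (Finset.card_lt_card hs) _ ?_ rfl)
      (ih _ (Finset.card_lt_card hs') _ ?_ rfl)
    · intro e ht hh
      refine hX e (fun hc => ?_) (Finset.mem_union_left _ hh)
      exact hadj _ hh _ ((Finset.mem_union.1 hc).resolve_left ht) (Adj.symm ⟨e, rfl, rfl⟩)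
    · intro e ht hh
      refine hX e (fun hc => ?_) (Finset.mem_union_right _ hh)
      exact hadj _ ((Finset.mem_union.1 hc).resolve_right ht) _ hh ⟨e, rfl, rfl⟩

/-- The differential of a function increasing only along `D` is a combination of bonds with
positive support in `D`. -/
lemma Connected.d_mem_span (hconn : G.Connected) (D : Set G.EO) (h : G.V → ℝ)
    (hD : ∀ e, h (G.tail e) < h (G.head e) → e ∈ D) :
    G.d h ∈ Submodule.span ℝ {β | G.IsBond β ∧ G.suppPlus β ⊆ D} := by
  induction hn : (Finset.univ.image h).card using Nat.strong_induction_on generalizing h with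
  | _ n ih =>
  subst hn
  by_cases hconst : ∀ u v, h u = h v
  · have : G.d h = 0 := by
      ext e
      simp only [d, Pi.zero_apply, hconst (G.head e) (G.tail e), sub_self]
    rw [this]; exact Submodule.zero_mem _
  push Not at hconst
  obtain ⟨u, v, huv⟩ := hconst
  have hmem : ∀ w, h w ∈ Finset.univ.image h := fun w =>
    Finset.mem_image_of_mem _ (Finset.mem_univ w)
  obtain ⟨m, hm, hmax⟩ := (Finset.univ.image h).exists_max_image id ⟨_, hmem u⟩
  have hne : ((Finset.univ.image h).erase m).Nonempty := by
    by_cases hum : h u = m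
    · exact ⟨h v, Finset.mem_erase.2 ⟨fun hv => huv (hum.trans hv.symm), hmem v⟩⟩
    · exact ⟨h u, Finset.mem_erase.2 ⟨hum, hmem u⟩⟩
  obtain ⟨m', hm', hmax'⟩ := ((Finset.univ.image h).erase m).exists_max_image id hne
  simp only [id] at hmax hmax'
  have hlt : m' < m := lt_of_le_of_ne (hmax _ (Finset.mem_of_mem_erase hm'))
    (Finset.ne_of_mem_erase hm')
  have hle : ∀ w, h w ≠ m → h w ≤ m' := fun w hw => hmax' _ (Finset.mem_erase.2 ⟨hw, hmem w⟩)
  set X : Finset G.V := Finset.univ.filter fun w => h w = m with hXdef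
  have hdecomp : h = (fun w => min (h w) m') + (m - m') • G.ind X := by
    ext w
    by_cases hw : h w = m
    · simp [ind, X, hw, hlt.le]
    · simp [ind, X, hw, hle w hw]
  have hd : G.d h = G.d (fun w => min (h w) m') + (m - m') • G.d (G.ind X) := by
    conv_lhs => rw [hdecomp]
    rw [← dLinear_apply, map_add, map_smul]
    rfl
  rw [hd]
  refine Submodule.add_mem _ (ih _ ?_ _ ?_ rfl)
    (Submodule.smul_mem _ _ (hconn.d_ind_mem_span D X ?_))
  · apply Finset.card_lt_card
    refine lt_of_le_of_lt ?_ (Finset.erase_ssubset hm)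
    intro y hy
    obtain ⟨w, -, rfl⟩ := Finset.mem_image.1 hy
    by_cases hw : h w = m
    · simpa only [hw, min_eq_right hlt.le] using hm'
    · simpa only [min_eq_left (hle w hw)] using Finset.mem_erase.2 ⟨hw, hmem w⟩
  · intro e he
    refine hD e (lt_of_not_ge fun hge => ?_)
    exact absurd he (not_lt.2 (min_le_min_right m' hge))
  · intro e ht hh
    simp only [X, Finset.mem_filter, Finset.mem_univ, true_and] at ht hh
    exact hD e (hh ▸ lt_of_le_of_ne (hmax _ (hmem _)) ht)

/-- A cochain vanishes off `D ∪ rev D` when it lies in the span of the edge vectors of `D`. -/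
lemma eq_zero_of_mem_span_chi {D : Set G.EO} {x : G.EO → ℝ}
    (hx : x ∈ Submodule.span ℝ {x | ∃ e ∈ D, x = G.chi ℝ e}) {e : G.EO}
    (he : e ∉ D) (he' : G.rev e ∉ D) : x e = 0 := by
  induction hx using Submodule.span_induction with
  | mem x hx =>
    obtain ⟨f, hf, rfl⟩ := hx
    have h1 : e ≠ f := fun h => he (h ▸ hf)
    have h2 : e ≠ G.rev f := fun h => he' (by rwa [h, G.rev_rev])
    simp [chi, h1, h2]
  | zero => rfl
  | add x y _ _ hx hy => simp [hx, hy]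
  | smul c x _ hx => simp [hx]

/-- An antisymmetric cochain with positive support in an antisymmetric `D` is a combination of
the edge vectors of `D`. -/
lemma mem_span_chi {D : Set G.EO} (hD : ∀ e ∈ D, G.rev e ∉ D) {x : G.EO → ℝ}
    (hx : G.IsC1 x) (hs : G.suppPlus x ⊆ D) :
    x ∈ Submodule.span ℝ {x | ∃ e ∈ D, x = G.chi ℝ e} := by
  have hsum : x = ∑ e ∈ Finset.univ.filter (· ∈ D), x e • G.chi ℝ e := by
    ext f
    rw [Finset.sum_apply]
    by_cases hf : f ∈ D
    · rw [Finset.sum_eq_single f]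
      · simp [chi]
      · intro e he hne
        have h2 : f ≠ G.rev e := by
          rintro rfl
          exact hD e (Finset.mem_filter.1 he).2 hf
        simp [chi, hne.symm, h2]
      · simp [hf]
    · rw [Finset.sum_eq_single (G.rev f)]
      · simp [chi, (G.rev_ne f).symm, G.rev_rev, hx f]
      · intro e he hne
        have h1 : f ≠ e := fun h => hf (h ▸ (Finset.mem_filter.1 he).2)
        have h2 : f ≠ G.rev e := fun h => hne (by rw [h, G.rev_rev])
        simp [chi, h1, h2]
      · intro hr
        have hr' : G.rev f ∉ D := by simpa using hr
        have h1 : ¬ 0 < x (G.rev f) := fun h => hr' (hs h)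
        have h2 : ¬ 0 < x f := fun h => hf (hs h)
        rw [hx f] at h1
        have : x (G.rev f) = 0 := by rw [hx f]; linarith
        simp [this]
  rw [hsum]
  exact Submodule.sum_mem _ fun e he =>
    Submodule.smul_mem _ _ (Submodule.subset_span ⟨e, (Finset.mem_filter.1 he).2, rfl⟩)

end OrGraph

/-- `ℝσ_D = F_ℝ ∩ ℝσ_{𝔼(D)}` for a coherent acyclic orientation `D`
of a cut subgraph of `G`. -/
theorem span_bondCone_eq_cutSpace_inter_span_edgeCone (G : OrGraph) (hconn : G.Connected)
    (D : Set G.EO) (hD : G.IsCAC D) :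
    (Submodule.span ℝ (G.bondCone D) : Set (G.EO → ℝ)) =
      G.cutSpace ∩ (Submodule.span ℝ (G.edgeCone D) : Set (G.EO → ℝ)) := by
  obtain ⟨r, hr⟩ := hD
  have hmemD : ∀ e, e ∈ D ↔ r (G.tail e) < r (G.head e) := fun e => by rw [hr]; rfl
  rw [OrGraph.bondCone, OrGraph.edgeCone, OrGraph.span_coneGen, OrGraph.span_coneGen]
  apply Set.Subset.antisymm
  · have hcut : G.cutSpace = (LinearMap.range G.dLinear : Set (G.EO → ℝ)) := by
      ext x
      simp only [OrGraph.cutSpace, Set.mem_ofPred_eq, SetLike.mem_coe, LinearMap.mem_range,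
        OrGraph.dLinear_apply, eq_comm]
    rw [hcut, ← Submodule.coe_inf, SetLike.coe_subset_coe, Submodule.span_le]
    rintro β ⟨⟨X, -, -, -, -, rfl⟩, hs⟩
    refine ⟨⟨G.ind X, rfl⟩, OrGraph.mem_span_chi ?_ ?_ hs⟩
    · intro e he he'
      rw [hmemD] at he he'
      rw [G.tail_rev, G.head_rev] at he'
      omega
    · intro e
      simp only [OrGraph.d, G.tail_rev, G.head_rev, neg_sub]
  · rintro x ⟨⟨f, rfl⟩, hx⟩
    set N : ℝ := ∑ e, |G.d f e| with hN
    have hNe : ∀ e, |G.d f e| ≤ N := fun e =>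
      Finset.single_le_sum (f := fun e => |G.d f e|) (fun _ _ => abs_nonneg _)
        (Finset.mem_univ e)
    have hN0 : 0 ≤ N := Finset.sum_nonneg fun _ _ => abs_nonneg _
    let ρ : G.V → ℝ := fun v => r v
    have hdf : G.d f = G.d (f + N • ρ) - N • G.d ρ := by
      simp only [← OrGraph.dLinear_apply, map_add, map_smul, add_sub_cancel_right]
    rw [hdf]
    refine Submodule.sub_mem _ (hconn.d_mem_span D _ ?_)
      (Submodule.smul_mem _ _ (hconn.d_mem_span D _ ?_))
    · intro e he
      by_contra hne
      have hle : r (G.head e) ≤ r (G.tail e) := not_lt.1 fun h => hne ((hmemD e).2 h)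
      simp only [Pi.add_apply, Pi.smul_apply, smul_eq_mul, ρ] at he
      rcases hle.eq_or_lt with heq | hlt
      · have h0 : G.d f e = 0 := by
          refine OrGraph.eq_zero_of_mem_span_chi hx hne fun h => ?_
          rw [hmemD, G.tail_rev, G.head_rev] at h
          omega
        rw [heq] at he
        simp only [OrGraph.d] at h0
        linarith
      · have h1 : (r (G.head e) : ℝ) + 1 ≤ r (G.tail e) := by exact_mod_cast hlt
        have h2 := (le_abs_self _).trans (hNe e)
        have h3 := mul_le_mul_of_nonneg_left h1 hN0
        simp only [OrGraph.d] at h2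
        linarith
    · intro e he
      exact (hmemD e).2 (Nat.cast_lt.mp he)
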